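/- Suppose G_1, …, G_m are finite subgraphs of the infinite path Path_ℤ with G_1 ∪ ⋯ ∪ G_m = Path_k. Then there exists a shift permutation σ of {1,…,m} such that λΔ⃗(G_{σ(1)},…,G_{σ(m)}) ≥ √(k/8). -/

import Mathlib

noncomputable section

/-- A finite subgraph of the infinite path `Path_ℤ`, identified with its (finite) edge set:
the integer `i` encodes the edge `{i-1, i}` of `Path_ℤ`. -/
abbrev PGraph := Finset ℤ

/-- The connected component of the edge `i` in `G`: all edges `j ∈ G` such that every edge
lying between `i` and `j` also belongs to `G`. -/
def comp (G : PGraph) (i : ℤ) : PGraph :=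
  G.filter fun j => ∀ l ∈ Finset.Icc (min i j) (max i j), l ∈ G

/-- `Δ(G)`: the number of connected components of `G`. -/
def Delta (G : PGraph) : ℕ := (G.filter fun i => i - 1 ∉ G).card

/-- `λ(G)`: the maximum number of edges of a connected component of `G`. -/
def lam (G : PGraph) : ℕ := G.sup fun i => (comp G i).card

/-- `G ⊖ F`: the union of the connected components of `G` that are vertex-disjoint from `F`.
(The edges `{i-1,i}` and `{f-1,f}` share a vertex iff `|i - f| ≤ 1`.) -/
def ominus (G F : PGraph) : PGraph :=
  G.filter fun i => ∀ j ∈ comp G i, ∀ f ∈ F, 1 < (j - f).natAbs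

/-- `Path_k`: the subgraph of `Path_ℤ` with edges `{i-1,i}` for `1 ≤ i ≤ k`. -/
def pathk (k : ℕ) : PGraph := Finset.Icc 1 (k : ℤ)

/-- `Δ⃗(G_1,…,G_m ∣ F)`. -/
def dvecFrom : PGraph → List PGraph → ℕ
  | _, [] => 0
  | F, G :: L => Delta (ominus G F) + dvecFrom (F ∪ G) L

/-- `Δ⃗(G_1,…,G_m)`. -/
def dvec (L : List PGraph) : ℕ := dvecFrom ∅ L

def lvecFrom : PGraph → List PGraph → ℕ
  | _, [] => 0
  | F, G :: L => lam (ominus G F) + lvecFrom (F ∪ G) L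

/-- `λ⃗(G_1,…,G_m)`. -/
def lvec (L : List PGraph) : ℕ := lvecFrom ∅ L

def ldvecFrom : PGraph → List PGraph → ℕ
  | _, [] => 0
  | F, G :: L => lam (ominus G F) * Delta (ominus G F) + ldvecFrom (F ∪ G) L

/-- `λΔ⃗(G_1,…,G_m)`. -/
def ldvec (L : List PGraph) : ℕ := ldvecFrom ∅ L

/-- The sequence `G_1, …, G_m` as a list. -/
def seqList {m : ℕ} (G : Fin m → PGraph) : List PGraph := (List.finRange m).map G

/-- `G_1 ∪ ⋯ ∪ G_{j-1}` (the union of the entries strictly before `j`). -/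
def unionBelow {m : ℕ} (G : Fin m → PGraph) (j : Fin m) : PGraph :=
  (Finset.univ.filter fun i => i < j).biUnion G

/-- A shift permutation: `σ(j) ≥ j - 1` for all `j`. -/
def IsShiftPerm {m : ℕ} (σ : Equiv.Perm (Fin m)) : Prop :=
  ∀ j : Fin m, (j : ℕ) ≤ (σ j : ℕ) + 1

lemma mem_comp {G : PGraph} {i j : ℤ} :
    j ∈ comp G i ↔ j ∈ G ∧ ∀ l, min i j ≤ l → l ≤ max i j → l ∈ G := by
  simp only [comp, Finset.mem_filter, Finset.mem_Icc, and_imp]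

lemma mem_comp_self {G : PGraph} {i : ℤ} (hi : i ∈ G) : i ∈ comp G i := by
  refine mem_comp.2 ⟨hi, fun l h1 h2 => ?_⟩
  rwa [show l = i by omega]

lemma mem_comp_symm {G : PGraph} {i j : ℤ} (hi : i ∈ G) (h : j ∈ comp G i) : i ∈ comp G j :=
  mem_comp.2 ⟨hi, fun l h1 h2 => (mem_comp.1 h).2 l (by omega) (by omega)⟩

lemma mem_comp_trans {G : PGraph} {i j l : ℤ} (h : j ∈ comp G i) (h' : l ∈ comp G j) :
    l ∈ comp G i := by
  rw [mem_comp] at *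
  refine ⟨h'.1, fun x h1 h2 => ?_⟩
  by_cases hx : min i j ≤ x ∧ x ≤ max i j
  · exact h.2 x hx.1 hx.2
  · exact h'.2 x (by omega) (by omega)

lemma card_comp_le_lam {G : PGraph} {i : ℤ} (hi : i ∈ G) : (comp G i).card ≤ lam G :=
  Finset.le_sup (f := fun i => (comp G i).card) hi

/-- Two edges of a component are at distance less than the size of the component. -/
lemma natAbs_sub_lt_card_comp {G : PGraph} {i j : ℤ} (h : j ∈ comp G i) :
    (i - j).natAbs < (comp G i).card := by
  have hsub : Finset.Icc (min i j) (max i j) ⊆ comp G i := by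
    intro l hl
    rw [Finset.mem_Icc] at hl
    have hG := (mem_comp.1 h).2
    exact mem_comp.2 ⟨hG l hl.1 hl.2, fun x h1 h2 => hG x (by omega) (by omega)⟩
  have := Finset.card_le_card hsub
  rw [Int.card_Icc] at this
  omega

lemma exists_left_end {G : PGraph} {i : ℤ} (hi : i ∈ G) :
    ∃ s ∈ comp G i, s - 1 ∉ G := by
  obtain ⟨s, hs, hmin⟩ := Finset.exists_min_image (comp G i) id ⟨i, mem_comp_self hi⟩
  refine ⟨s, hs, fun h => ?_⟩
  have hadj : s - 1 ∈ comp G s := by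
    refine mem_comp.2 ⟨h, fun l h1 h2 => ?_⟩
    obtain rfl | rfl : l = s ∨ l = s - 1 := by omega
    · exact (mem_comp.1 hs).1
    · exact h
  have := hmin _ (mem_comp_trans hs hadj)
  simp at this

lemma card_le_lam_mul_Delta (G : PGraph) : G.card ≤ lam G * Delta G := by
  have hsub : G ⊆ (G.filter fun i => i - 1 ∉ G).biUnion (comp G) := by
    intro i hi
    obtain ⟨s, hs, hs'⟩ := exists_left_end hi
    exact Finset.mem_biUnion.2
      ⟨s, Finset.mem_filter.2 ⟨(mem_comp.1 hs).1, hs'⟩, mem_comp_symm hi hs⟩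
  calc G.card ≤ _ := Finset.card_le_card hsub
    _ ≤ Delta G * lam G :=
      Finset.card_biUnion_le_card_mul _ _ _ fun s hs =>
        card_comp_le_lam (Finset.mem_filter.1 hs).1
    _ = _ := mul_comm _ _

lemma comp_subset_ominus {G F : PGraph} {i : ℤ} (h : i ∈ ominus G F) :
    comp G i ⊆ ominus G F := by
  intro j hj
  exact Finset.mem_filter.2 ⟨(mem_comp.1 hj).1, fun x hx =>
    (Finset.mem_filter.1 h).2 x (mem_comp_trans hj hx)⟩

/-- The contribution `λ(G ⊖ F) · Δ(G ⊖ F)` of an entry `G` preceded by entries with union `F`. -/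
def gain (G F : PGraph) : ℕ := lam (ominus G F) * Delta (ominus G F)

lemma card_ominus_le_gain (G F : PGraph) : (ominus G F).card ≤ gain G F :=
  card_le_lam_mul_Delta _

lemma exists_close_of_notMem_ominus {G F : PGraph} {i : ℤ} (hi : i ∈ G) (h : i ∉ ominus G F) :
    ∃ f ∈ F, (i - f).natAbs ≤ (comp G i).card := by
  simp only [ominus, Finset.mem_filter, not_and, not_forall] at h
  obtain ⟨j, hj, f, hf, hjf⟩ := h hi
  have := natAbs_sub_lt_card_comp hj
  exact ⟨f, hf, by omega⟩

lemma exists_close_of_gain_lt {G F : PGraph} {i : ℤ} (hi : i ∈ G)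
    (h : gain G F < (comp G i).card) :
    ∃ f ∈ F, (i - f).natAbs ≤ (comp G i).card := by
  refine exists_close_of_notMem_ominus hi fun h' => ?_
  have := Finset.card_le_card (comp_subset_ominus h')
  have := card_ominus_le_gain G F
  omega

/-- The union of the first `n` entries of a sequence. -/
def prefixUnion (G : ℕ → PGraph) (n : ℕ) : PGraph := (Finset.range n).biUnion G

lemma mem_prefixUnion {G : ℕ → PGraph} {n : ℕ} {e : ℤ} :
    e ∈ prefixUnion G n ↔ ∃ j < n, e ∈ G j := by
  simp [prefixUnion]

lemma prefixUnion_succ (G : ℕ → PGraph) (n : ℕ) :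
    prefixUnion G (n + 1) = prefixUnion G n ∪ G n := by
  ext e
  simp only [prefixUnion, Finset.range_add_one, Finset.biUnion_insert, Finset.mem_union]
  tauto

/-- The sum `λΔ⃗` of the first `n` entries of a sequence. -/
def totalGain (G : ℕ → PGraph) (n : ℕ) : ℕ :=
  ∑ i ∈ Finset.range n, gain (G i) (prefixUnion G i)

lemma ldvecFrom_append_singleton (L : List PGraph) (F X : PGraph) :
    ldvecFrom F (L ++ [X]) = ldvecFrom F L + gain X (L.foldl (· ∪ ·) F) := by
  induction L generalizing F with
  | nil => simp [ldvecFrom, gain]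
  | cons A L ih => simp [ldvecFrom, ih, add_assoc]

lemma foldl_union_map_range (G : ℕ → PGraph) (n : ℕ) :
    ((List.range n).map G).foldl (· ∪ ·) ∅ = prefixUnion G n := by
  induction n with
  | zero => simp [prefixUnion]
  | succ n ih => simp [List.range_succ, ih, prefixUnion_succ]

lemma ldvec_map_range (G : ℕ → PGraph) (n : ℕ) :
    ldvec ((List.range n).map G) = totalGain G n := by
  induction n with
  | zero => simp [ldvec, ldvecFrom, totalGain]
  | succ n ih =>
    rw [List.range_succ, List.map_append, List.map_singleton, ldvec,
      ldvecFrom_append_singleton, foldl_union_map_range, ← ldvec, ih, totalGain, totalGain,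
      Finset.sum_range_succ]

lemma seqList_eq_map_range {m : ℕ} {G : Fin m → PGraph} {G' : ℕ → PGraph}
    (h : ∀ i : Fin m, G i = G' i) : seqList G = (List.range m).map G' := by
  rw [seqList, ← List.map_coe_finRange_eq_range, List.map_map]
  exact List.map_congr_left fun i _ => h i

/-- `σ` restricts to a shift permutation of `{0, …, n - 1}`. -/
structure IsShiftOn (σ : ℕ → ℕ) (n : ℕ) : Prop where
  mapsTo : ∀ i < n, σ i < n
  inj : ∀ i < n, ∀ j < n, σ i = σ j → i = j
  le_succ : ∀ i < n, i ≤ σ i + 1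

lemma isShiftOn_id (n : ℕ) : IsShiftOn id n :=
  ⟨fun _ h => h, fun _ _ _ _ h => h, fun i _ => Nat.le_succ i⟩

lemma IsShiftOn.prefixUnion_comp {σ : ℕ → ℕ} {n : ℕ} (h : IsShiftOn σ n) (G : ℕ → PGraph) :
    prefixUnion (G ∘ σ) n = prefixUnion G n := by
  have himg : (Finset.range n).image σ = Finset.range n := by
    refine Finset.eq_of_subset_of_card_le (fun x hx => ?_) ?_
    · obtain ⟨i, hi, rfl⟩ := Finset.mem_image.1 hx
      exact Finset.mem_range.2 (h.mapsTo i (Finset.mem_range.1 hi))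
    · rw [Finset.card_image_of_injOn]
      intro i hi j hj
      exact h.inj i (by simpa using hi) j (by simpa using hj)
  rw [prefixUnion, prefixUnion]
  conv_rhs => rw [← himg, Finset.image_biUnion]
  rfl

/-- Append to a shift permutation of `{0, …, a - 1}` the block `{a, …, n}`, with its last
element moved to the front. -/
def appendBlock (σ : ℕ → ℕ) (a n : ℕ) (i : ℕ) : ℕ :=
  if i < a then σ i else if i = a then n else i - 1

lemma IsShiftOn.appendBlock {σ : ℕ → ℕ} {a n : ℕ} (h : IsShiftOn σ a) (han : a ≤ n) :
    IsShiftOn (appendBlock σ a n) (n + 1) := by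
  refine ⟨fun i hi => ?_, fun i hi j hj hij => ?_, fun i hi => ?_⟩
  · have := h.mapsTo i
    unfold _root_.appendBlock
    split_ifs <;> grind
  · have h1 := h.mapsTo i
    have h2 := h.mapsTo j
    have h3 := h.inj i
    unfold _root_.appendBlock at hij
    split_ifs at hij <;> grind
  · have := h.le_succ i
    unfold _root_.appendBlock
    split_ifs <;> grind

lemma totalGain_appendBlock {σ : ℕ → ℕ} {a n : ℕ} (h : IsShiftOn σ a) (han : a ≤ n)
    (G : ℕ → PGraph) :
    totalGain (G ∘ σ) a + gain (G n) (prefixUnion G a) ≤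
      totalGain (G ∘ appendBlock σ a n) (n + 1) := by
  have hpre : ∀ i ≤ a, prefixUnion (G ∘ appendBlock σ a n) i = prefixUnion (G ∘ σ) i := by
    intro i hi
    refine Finset.biUnion_congr rfl fun j hj => ?_
    have : j < a := by have := Finset.mem_range.1 hj; omega
    simp [appendBlock, this]
  have hsum : totalGain (G ∘ appendBlock σ a n) (a + 1) =
      totalGain (G ∘ σ) a + gain (G n) (prefixUnion G a) := by
    rw [totalGain, Finset.sum_range_succ, hpre a le_rfl, h.prefixUnion_comp]
    refine congrArg₂ (· + ·) ?_ ?_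
    · refine Finset.sum_congr rfl fun i hi => ?_
      have hia := Finset.mem_range.1 hi
      rw [hpre i hia.le]
      simp [appendBlock, hia]
    · simp [appendBlock]
  rw [← hsum]
  exact Finset.sum_le_sum_of_subset (Finset.range_mono (by omega))

/-- The largest sum, over partitions of `{0, …, n - 1}` into intervals, of the gains obtained by
moving the last entry of each interval to its front. -/
def bestGain (G : ℕ → PGraph) : ℕ → ℕ
  | 0 => 0
  | n + 1 => Finset.univ.sup fun a : Fin (n + 1) =>
      bestGain G a + gain (G n) (prefixUnion G a)

lemma bestGain_add_gain_le (G : ℕ → PGraph) {a n : ℕ} (h : a ≤ n) :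
    bestGain G a + gain (G n) (prefixUnion G a) ≤ bestGain G (n + 1) := by
  rw [bestGain]
  exact Finset.le_sup (f := fun a : Fin (n + 1) =>
    bestGain G a + gain (G n) (prefixUnion G a)) (Finset.mem_univ ⟨a, by omega⟩)

lemma bestGain_mono (G : ℕ → PGraph) : Monotone (bestGain G) :=
  monotone_nat_of_le_succ fun n => by
    have := bestGain_add_gain_le G (le_refl n)
    omega

lemma exists_isShiftOn_bestGain_le (G : ℕ → PGraph) (n : ℕ) :
    ∃ σ, IsShiftOn σ n ∧ bestGain G n ≤ totalGain (G ∘ σ) n := by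
  induction n using Nat.strong_induction_on with
  | _ n ih =>
    cases n with
    | zero => exact ⟨id, isShiftOn_id 0, by simp [bestGain]⟩
    | succ n =>
      obtain ⟨a, -, ha⟩ := Finset.exists_mem_eq_sup Finset.univ Finset.univ_nonempty
        fun a : Fin (n + 1) => bestGain G a + gain (G n) (prefixUnion G a)
      obtain ⟨σ, hσ, hle⟩ := ih a a.2
      have han : (a : ℕ) ≤ n := by omega
      refine ⟨appendBlock σ a n, hσ.appendBlock han, ?_⟩
      rw [bestGain, ha]
      exact (Nat.add_le_add_right hle _).trans (totalGain_appendBlock hσ han G)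

/-- Every covered edge is close to an edge of a component that was disjoint from all
preceding entries. -/
lemma exists_fresh_close (G : ℕ → PGraph) (n : ℕ) :
    ∀ e ∈ prefixUnion G n, ∃ j < n, ∃ f ∈ ominus (G j) (prefixUnion G j),
      (e - f).natAbs ≤ bestGain G n + bestGain G (n - 1) := by
  induction n using Nat.strong_induction_on with
  | _ n ih =>
    intro e he
    cases n with
    | zero => simp [prefixUnion] at he
    | succ n =>
      have hn := bestGain_mono G (Nat.le_succ n)
      have hn' := bestGain_mono G (Nat.sub_le n 1)
      rw [Nat.add_sub_cancel]
      rw [prefixUnion_succ, Finset.mem_union] at he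
      by_cases hold : e ∈ prefixUnion G n
      · obtain ⟨j, hj, f, hf, hd⟩ := ih n (by omega) e hold
        exact ⟨j, by omega, f, hf, by simp only [Nat.succ_eq_add_one] at *; omega⟩
      have heG : e ∈ G n := he.resolve_left hold
      by_cases hfresh : e ∈ ominus (G n) (prefixUnion G n)
      · exact ⟨n, by omega, e, hfresh, by simp⟩
      set c := (comp (G n) e).card with hc
      have hcpos : 0 < c := Finset.card_pos.2 ⟨e, mem_comp_self heG⟩
      by_cases hjump : bestGain G n + c ≤ bestGain G (n + 1)
      · obtain ⟨x, hx, hxd⟩ := exists_close_of_notMem_ominus heG hfresh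
        obtain ⟨j, hj, f, hf, hd⟩ := ih n (by omega) x hx
        exact ⟨j, by omega, f, hf, by omega⟩
      have hex : ∃ a, bestGain G (n + 1) < bestGain G a + c := ⟨n, by omega⟩
      obtain ⟨a, ha, hmin⟩ : ∃ a, bestGain G (n + 1) < bestGain G a + c ∧
          ∀ b < a, bestGain G b + c ≤ bestGain G (n + 1) :=
        ⟨Nat.find hex, Nat.find_spec hex, fun b hb => not_lt.1 (Nat.find_min hex hb)⟩
      have han : a ≤ n := by
        by_contra! h
        exact hjump (hmin n h)
      have hgain := bestGain_add_gain_le G han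
      obtain ⟨x, hx, hxd⟩ := exists_close_of_gain_lt (F := prefixUnion G a) heG (by omega)
      obtain ⟨j, hj, f, hf, hd⟩ := ih a (by omega) x hx
      have h1 := bestGain_mono G han
      have h2 := hmin (a - 1) (by omega)
      exact ⟨j, by omega, f, hf, by omega⟩

lemma card_prefixUnion_le (G : ℕ → PGraph) (n : ℕ) :
    (prefixUnion G n).card ≤ totalGain G n * (4 * bestGain G n + 1) := by
  set W := bestGain G n with hW
  set R := (Finset.range n).biUnion fun j => ominus (G j) (prefixUnion G j) with hR
  have hRcard : R.card ≤ totalGain G n :=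
    Finset.card_biUnion_le.trans (Finset.sum_le_sum fun j _ => card_ominus_le_gain _ _)
  have hsub : prefixUnion G n ⊆ R.biUnion fun f => Finset.Icc (f - 2 * W) (f + 2 * W) := by
    intro e he
    obtain ⟨j, hj, f, hf, hd⟩ := exists_fresh_close G n e he
    have := bestGain_mono G (Nat.sub_le n 1)
    refine Finset.mem_biUnion.2
      ⟨f, Finset.mem_biUnion.2 ⟨j, Finset.mem_range.2 hj, hf⟩, Finset.mem_Icc.2 ?_⟩
    omega
  calc (prefixUnion G n).card ≤ _ := Finset.card_le_card hsub
    _ ≤ R.card * (4 * W + 1) :=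
      Finset.card_biUnion_le_card_mul _ _ _ fun f _ => by rw [Int.card_Icc]; omega
    _ ≤ _ := Nat.mul_le_mul_right _ hRcard

/-- A shift permutation of `{0, …, m - 1}` whose value `S` satisfies `|G_1 ∪ ⋯ ∪ G_m| ≤ 8 S²`. -/
lemma exists_isShiftOn_card_le (G : ℕ → PGraph) (m : ℕ) :
    ∃ σ, IsShiftOn σ m ∧ (prefixUnion G m).card ≤ 8 * totalGain (G ∘ σ) m ^ 2 := by
  obtain ⟨σ, hσ, hle⟩ := exists_isShiftOn_bestGain_le G m
  have hcard := card_prefixUnion_le G m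
  have hbound : ∀ S, totalGain G m ≤ S → bestGain G m ≤ S →
      (prefixUnion G m).card ≤ 8 * S ^ 2 := by
    intro S h1 h2
    calc _ ≤ _ := hcard
      _ ≤ S * (4 * S + 1) := by gcongr
      _ ≤ 8 * S ^ 2 := by nlinarith [Nat.le_self_pow two_ne_zero S]
  rcases le_total (totalGain G m) (totalGain (G ∘ σ) m) with h | h
  · exact ⟨σ, hσ, hbound _ h hle⟩
  · exact ⟨id, isShiftOn_id m, hbound _ le_rfl (hle.trans h)⟩

/-- **Main Lemma (II).**  If `G_1 ∪ ⋯ ∪ G_m = Path_k`, then there is a shift permutation `σ`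
with `λΔ⃗(G_{σ(1)},…,G_{σ(m)}) ≥ √(k/8)`. -/
theorem main_lemma_II (k m : ℕ) (hk : 1 ≤ k) (G : Fin m → PGraph)
    (hcov : Finset.univ.biUnion G = pathk k) :
    ∃ σ : Equiv.Perm (Fin m), IsShiftPerm σ ∧
      Real.sqrt ((k : ℝ) / 8) ≤ (ldvec (seqList fun j => G (σ j)) : ℝ) := by
  set G' : ℕ → PGraph := fun i => if h : i < m then G ⟨i, h⟩ else ∅ with hG'
  have hG'G : ∀ i (h : i < m), G' i = G ⟨i, h⟩ := fun i h => by simp [hG', h]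
  have hunion : prefixUnion G' m = pathk k := by
    rw [← hcov]
    ext e
    simp only [mem_prefixUnion, Finset.mem_biUnion, Finset.mem_univ, true_and]
    constructor
    · rintro ⟨j, hj, he⟩
      exact ⟨⟨j, hj⟩, hG'G j hj ▸ he⟩
    · rintro ⟨j, he⟩
      exact ⟨j, j.2, by rw [hG'G j j.2]; exact he⟩
  obtain ⟨σ, hσ, hle⟩ := exists_isShiftOn_card_le G' m
  have hinj : Function.Injective fun i : Fin m => (⟨σ i, hσ.mapsTo i i.2⟩ : Fin m) := by
    intro i j hij
    exact Fin.ext (hσ.inj i i.2 j j.2 (Fin.mk.inj hij))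
  refine ⟨Equiv.ofBijective _ (Finite.injective_iff_bijective.1 hinj),
    fun j => hσ.le_succ j j.2, ?_⟩
  have hseq : (seqList fun j => G (Equiv.ofBijective _
      (Finite.injective_iff_bijective.1 hinj) j)) = (List.range m).map (G' ∘ σ) :=
    seqList_eq_map_range fun i => (hG'G (σ i) (hσ.mapsTo i i.2)).symm
  rw [hseq, ldvec_map_range]
  have hk8 : k ≤ 8 * totalGain (G' ∘ σ) m ^ 2 := by
    rw [hunion, pathk, Int.card_Icc] at hle
    omega
  have hk8' : (k : ℝ) ≤ 8 * (totalGain (G' ∘ σ) m : ℝ) ^ 2 := by exact_mod_cast hk8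
  exact Real.sqrt_le_iff.2 ⟨Nat.cast_nonneg _, by linarith⟩
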